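/- The total variation distance between the Wishart distributions W_n(Id, d-1) and W_n(Id, d) is at most (1/2)·sqrt(Var[det W]/ E[det W]^2) where W ∼ W_n(Id, d-1); in particular it is at most (1/2)·sqrt(d(d+1)/((d-n)(d-n+1)) − 1). -/

import Mathlib

open MeasureTheory ProbabilityTheory Matrix

instance {m n : Type*} : MeasurableSpace (Matrix m n ℝ) :=
  inferInstanceAs (MeasurableSpace (m → n → ℝ))

/-- The Wishart distribution `W_n(Id, p)`. -/
noncomputable def wishart (n p : ℕ) : Measure (Matrix (Fin n) (Fin n) ℝ) :=
  (Measure.pi fun _ : Fin n => Measure.pi fun _ : Fin p => gaussianReal 0 1).map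
    (fun G => Matrix.of G * (Matrix.of G)ᵀ)

noncomputable def tvDist {W : Type*} [MeasurableSpace W] (μ ν : Measure W) : ℝ :=
  ⨆ A : {s : Set W // MeasurableSet s}, |(μ A).toReal - (ν A).toReal|

/-- Standard Gaussian measure on `Fin m → ℝ`. -/
noncomputable abbrev gau (m : ℕ) : Measure (Fin m → ℝ) :=
  Measure.pi fun _ : Fin m => gaussianReal 0 1

/-- Euclidean norm of a vector. -/
noncomputable def enrm {m : ℕ} (v : Fin m → ℝ) : ℝ := ‖(WithLp.toLp 2 v : EuclideanSpace ℝ (Fin m))‖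

lemma enrm_nonneg {m : ℕ} (v : Fin m → ℝ) : 0 ≤ enrm v := norm_nonneg _

lemma enrm_sq {m : ℕ} (v : Fin m → ℝ) : enrm v ^ 2 = ∑ i, v i ^ 2 := by
  simp [enrm, EuclideanSpace.real_norm_sq_eq]

lemma measurable_enrm {m : ℕ} : Measurable (enrm (m := m)) := by
  unfold enrm
  fun_prop

lemma lintegral_polar {E : Type*} [NormedAddCommGroup E] [NormedSpace ℝ E] [MeasurableSpace E]
    [BorelSpace E] [FiniteDimensional ℝ E] [Nontrivial E] (μ : Measure E) [μ.IsAddHaarMeasure]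
    (f : ℝ → ENNReal) (hf : Measurable f) :
    ∫⁻ x, f ‖x‖ ∂μ = μ.toSphere Set.univ *
      ∫⁻ y in Set.Ioi (0 : ℝ), ENNReal.ofReal (y ^ (Module.finrank ℝ E - 1)) * f y := by
  calc
    ∫⁻ x, f (‖x‖) ∂μ = ∫⁻ x : ({(0)}ᶜ : Set E), f (‖x.1‖) ∂(μ.comap (↑)) := by
      rw [lintegral_subtype_comap (measurableSet_singleton _).compl fun x ↦ f (‖x‖),
        restrict_compl_singleton]
    _ = ∫⁻ x, f x.2 ∂μ.toSphere.prod (.volumeIoiPow (Module.finrank ℝ E - 1)) := by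
      simpa using μ.measurePreserving_homeomorphUnitSphereProd.lintegral_comp_emb
        (Homeomorph.measurableEmbedding _) (f ∘ Subtype.val ∘ Prod.snd)
    _ = μ.toSphere Set.univ *
        ∫⁻ x : Set.Ioi (0 : ℝ), f x ∂.volumeIoiPow (Module.finrank ℝ E - 1) := by
      rw [lintegral_prod _ (by fun_prop)]
      simp [mul_comm]
    _ = _ := by
      simp only [Measure.volumeIoiPow]
      rw [lintegral_withDensity_eq_lintegral_mul _ (by fun_prop) (by fun_prop)]
      congr 1
      exact lintegral_subtype_comap measurableSet_Ioi
        fun a ↦ ENNReal.ofReal (a ^ (Module.finrank ℝ E - 1)) * f a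

lemma lintegral_gau_density (m : ℕ) (F : (Fin m → ℝ) → ENNReal) (hF : Measurable F) :
    ∫⁻ g, F g ∂(gau m) = ∫⁻ g, (∏ i, gaussianPDF 0 1 (g i)) * F g := by
  induction m with
  | zero =>
    have : (gau 0) = volume := by
      rw [volume_pi, gau, Measure.pi_of_empty, Measure.pi_of_empty]
    simp [this]
  | succ m ih =>
    have h1 := (measurePreserving_piFinSuccAbove (fun _ : Fin (m+1) => gaussianReal 0 1) 0).symm
    have h2 := (volume_preserving_piFinSuccAbove (fun _ : Fin (m+1) => ℝ) 0).symm
    rw [← h1.lintegral_comp hF, ← h2.lintegral_comp (by fun_prop)]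
    have hm := (MeasurableEquiv.piFinSuccAbove (fun _ : Fin (m+1) => ℝ) 0).symm.measurable
    rw [lintegral_prod _ (by fun_prop), Measure.volume_eq_prod, lintegral_prod _ (by fun_prop)]
    rw [lintegral_congr fun x => ih (fun y => F ((MeasurableEquiv.piFinSuccAbove
      (fun _ : Fin (m+1) => ℝ) 0).symm (x, y))) (by fun_prop)]
    rw [gaussianReal_of_var_ne_zero _ one_ne_zero, lintegral_withDensity_eq_lintegral_mul _
      (by fun_prop) (Measurable.lintegral_prod_right' (f := fun z : ℝ × (Fin m → ℝ) =>
        (∏ i, gaussianPDF 0 1 (z.2 i)) * F ((MeasurableEquiv.piFinSuccAbove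
      (fun _ : Fin (m+1) => ℝ) 0).symm z)) (by fun_prop))]
    refine lintegral_congr fun x => ?_
    simp only [Pi.mul_apply]
    rw [← lintegral_const_mul _ (by fun_prop)]
    refine lintegral_congr fun y => ?_
    simp [Fin.prod_univ_succ, MeasurableEquiv.piFinSuccAbove, mul_assoc]

lemma prod_gaussianPDF {m : ℕ} (g : Fin m → ℝ) :
    ∏ i, gaussianPDF 0 1 (g i) =
      ENNReal.ofReal ((√(2 * Real.pi))⁻¹ ^ m) * ENNReal.ofReal (Real.exp (- enrm g ^ 2 / 2)) := by
  simp only [gaussianPDF]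
  rw [← ENNReal.ofReal_prod_of_nonneg (fun i _ => gaussianPDFReal_nonneg _ _ _),
    ← ENNReal.ofReal_mul (by positivity)]
  congr 1
  simp only [gaussianPDFReal, Finset.prod_mul_distrib, ← Real.exp_sum, enrm_sq]
  simp [Finset.sum_div, Finset.sum_neg_distrib, neg_div]

lemma chi_law (m : ℕ) : ∃ K : ENNReal, K ≠ 0 ∧ K ≠ ⊤ ∧ ∀ h : ℝ → ENNReal, Measurable h →
    ∫⁻ g, h (enrm g) ∂(gau (m + 1)) = K * ∫⁻ y in Set.Ioi (0 : ℝ),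
      ENNReal.ofReal (y ^ m) * (ENNReal.ofReal (Real.exp (- y ^ 2 / 2)) * h y) := by
  refine ⟨ENNReal.ofReal ((√(2 * Real.pi))⁻¹ ^ (m+1)) *
    (volume : Measure (EuclideanSpace ℝ (Fin (m+1)))).toSphere Set.univ, ?_, ?_, ?_⟩
  · refine mul_ne_zero ?_ ?_
    · rw [Ne, ENNReal.ofReal_eq_zero, not_le]; positivity
    · rw [Ne, Measure.measure_univ_eq_zero]; exact Measure.toSphere_ne_zero _
  · exact ENNReal.mul_ne_top ENNReal.ofReal_ne_top (measure_ne_top _ _)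
  · intro h hh
    have hm := measurable_enrm (m := m + 1)
    rw [lintegral_gau_density _ _ (by fun_prop)]
    simp_rw [prod_gaussianPDF, mul_assoc]
    rw [lintegral_const_mul _ (by fun_prop)]
    congr 1
    have := lintegral_polar (volume : Measure (EuclideanSpace ℝ (Fin (m+1))))
      (fun y => ENNReal.ofReal (Real.exp (- y ^ 2 / 2)) * h y) (by fun_prop)
    simp only [finrank_euclideanSpace, Fintype.card_fin, Nat.add_sub_cancel] at this
    rw [← this, ← (PiLp.volume_preserving_toLp (Fin (m+1))).lintegral_comp (by fun_prop)]
    rfl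

lemma chi_shift (m : ℕ) : ∃ c : ENNReal, ∀ h : ℝ → ENNReal, Measurable h →
    ∫⁻ g, h (enrm g) ∂(gau (m + 2)) =
      c * ∫⁻ g, ENNReal.ofReal (enrm g) * h (enrm g) ∂(gau (m + 1)) := by
  obtain ⟨K, hK0, hK, h1⟩ := chi_law m
  obtain ⟨K', hK0', hK', h2⟩ := chi_law (m + 1)
  refine ⟨K' / K, fun h hh => ?_⟩
  rw [h2 h hh, h1 (fun y => ENNReal.ofReal y * h y) (by fun_prop), ← mul_assoc,
    ENNReal.div_mul_cancel hK0 hK]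
  congr 1
  refine setLIntegral_congr_fun measurableSet_Ioi fun y hy => ?_
  have hy : 0 < y := hy
  simp only [pow_succ]
  rw [ENNReal.ofReal_mul (by positivity)]
  ring

lemma lintegral_enrm_sq (m : ℕ) :
    ∫⁻ g, ENNReal.ofReal (enrm g ^ 2) ∂(gau m) = m := by
  have h1 : ∀ g : Fin m → ℝ, ENNReal.ofReal (enrm g ^ 2) = ∑ i, ENNReal.ofReal (g i ^ 2) := by
    intro g
    rw [enrm_sq, ENNReal.ofReal_sum_of_nonneg (fun i _ => sq_nonneg _)]
  simp_rw [h1]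
  rw [lintegral_finsetSum _ (by fun_prop)]
  have h2 : ∀ i : Fin m, ∫⁻ g, ENNReal.ofReal (g i ^ 2) ∂(gau m) = 1 := by
    intro i
    rw [(measurePreserving_eval (fun _ : Fin m => gaussianReal 0 1) i).lintegral_comp
      (f := fun x => ENNReal.ofReal (x ^ 2)) (by fun_prop)]
    have hI : MemLp (fun x : ℝ => x) 2 (gaussianReal 0 1) := memLp_id_gaussianReal 2
    rw [← ofReal_integral_eq_lintegral_ofReal hI.integrable_sq
      (Filter.Eventually.of_forall fun x => sq_nonneg x)]
    have := variance_id_gaussianReal (μ := 0) (v := 1)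
    rw [variance_eq_sub (memLp_id_gaussianReal 2)] at this
    simp at this
    simp [this]
  simp [h2]

lemma chi_moments (m : ℕ) :
    ∫⁻ g, ENNReal.ofReal (enrm g ^ 4) ∂(gau (m + 1)) = (m + 1) * (m + 3) := by
  obtain ⟨c, hc⟩ := chi_shift m
  obtain ⟨c', hc'⟩ := chi_shift (m + 1)
  have key : ∀ h : ℝ → ENNReal, Measurable h → ∫⁻ g, h (enrm g) ∂(gau (m + 3)) =
      c' * (c * ∫⁻ g, ENNReal.ofReal (enrm g ^ 2) * h (enrm g) ∂(gau (m + 1))) := by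
    intro h hh
    rw [hc' h hh, hc (fun y => ENNReal.ofReal y * h y) (by fun_prop)]
    simp_rw [sq, ENNReal.ofReal_mul (enrm_nonneg _), mul_assoc]
  have k1 := key (fun _ => 1) measurable_const
  have k2 := key (fun y => ENNReal.ofReal (y ^ 2)) (by fun_prop)
  simp only [mul_one, lintegral_enrm_sq, lintegral_one, measure_univ] at k1 k2
  have e : ∀ y : Fin (m+1) → ℝ, ENNReal.ofReal (enrm y ^ 2) * ENNReal.ofReal (enrm y ^ 2) =
    ENNReal.ofReal (enrm y ^ 4) := by
    intro y
    rw [← ENNReal.ofReal_mul (by positivity)]; ring_nf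
  simp_rw [e] at k2
  push_cast at k1 k2
  rw [k2]
  set I := ∫⁻ g, ENNReal.ofReal (enrm g ^ 4) ∂(gau (m + 1))
  calc I = 1 * I := (one_mul _).symm
    _ = (c' * (c * (m + 1))) * I := by rw [← k1]
    _ = _ := by ring

/-- Law of a Gaussian matrix. -/
noncomputable abbrev gauM (n p : ℕ) : Measure (Fin n → Fin p → ℝ) :=
  Measure.pi fun _ : Fin n => gau p

/-- Gram matrix. -/
def gramM {n p : ℕ} (G : Fin n → Fin p → ℝ) : Matrix (Fin n) (Fin n) ℝ :=
  Matrix.of G * (Matrix.of G)ᵀ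

lemma gram_apply {n p : ℕ} (G : Fin n → Fin p → ℝ) (i j : Fin n) :
    gramM G i j = ∑ k, G i k * G j k := by
  simp [gramM, Matrix.mul_apply]

lemma measurable_toMatrix {α : Type*} [MeasurableSpace α] {n m : ℕ}
    {f : α → Matrix (Fin n) (Fin m) ℝ} (h : ∀ i j, Measurable fun a => f a i j) : Measurable f :=
  measurable_pi_iff.2 fun i => measurable_pi_iff.2 fun j => h i j

lemma measurable_entry {n m : ℕ} (i : Fin n) (j : Fin m) :
    Measurable fun A : Matrix (Fin n) (Fin m) ℝ => A i j :=
  (measurable_pi_apply j).comp (measurable_pi_apply (X := fun _ : Fin n => Fin m → ℝ) i)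

lemma measurable_gram {n p : ℕ} : Measurable (gramM (n := n) (p := p)) := by
  refine measurable_toMatrix fun i j => ?_
  simp only [gram_apply]
  fun_prop

lemma measurable_det' {n : ℕ} : Measurable fun A : Matrix (Fin n) (Fin n) ℝ => A.det := by
  simp only [Matrix.det_apply]
  refine Finset.measurable_sum _ fun σ _ => ?_
  refine Measurable.const_smul ?_ _
  exact Finset.measurable_prod _ fun i _ => measurable_entry _ _

lemma wishart_eq (n p : ℕ) : wishart n p = (gauM n p).map gramM := rfl

lemma lintegral_wishart (n p : ℕ) (f : Matrix (Fin n) (Fin n) ℝ → ENNReal) (hf : Measurable f) :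
    ∫⁻ A, f A ∂(wishart n p) = ∫⁻ G, f (gramM G) ∂(gauM n p) := by
  rw [wishart_eq, lintegral_map hf measurable_gram]

instance (n p : ℕ) : IsProbabilityMeasure (wishart n p) := by
  rw [wishart_eq]
  exact Measure.isProbabilityMeasure_map measurable_gram.aemeasurable

/-- The block matrix `[r², r xᵀ; r x, x xᵀ + A]`. -/
def blk {n : ℕ} (r : ℝ) (x : Fin n → ℝ) (A : Matrix (Fin n) (Fin n) ℝ) :
    Matrix (Fin (n + 1)) (Fin (n + 1)) ℝ :=
  fun i j => Fin.cases (Fin.cases (r * r) (fun j => r * x j) j)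
    (fun i => Fin.cases (x i * r) (fun j => x i * x j + A i j) j) i

lemma det_blk {n : ℕ} (r : ℝ) (x : Fin n → ℝ) (A : Matrix (Fin n) (Fin n) ℝ) :
    (blk r x A).det = r ^ 2 * A.det := by
  let C : Matrix (Fin (n + 1)) (Fin (n + 1)) ℝ :=
    Matrix.of fun i j => Fin.cases (Fin.cases r (fun _ => 0) j)
      (fun i => Fin.cases (x i) (fun j => (1 : Matrix (Fin n) (Fin n) ℝ) i j) j) i
  let E : Matrix (Fin (n + 1)) (Fin (n + 1)) ℝ :=
    Matrix.of fun i j => Fin.cases (Fin.cases 1 (fun _ => 0) j)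
      (fun i => Fin.cases 0 (fun j => A i j) j) i
  have h : blk r x A = C * (E * Cᵀ) := by
    ext i j
    refine Fin.cases ?_ (fun i => ?_) i <;> refine Fin.cases ?_ (fun j => ?_) j <;>
      simp [blk, C, E, Matrix.mul_apply, Fin.sum_univ_succ, Matrix.one_apply]
  have hC : C.det = r := by
    rw [Matrix.det_succ_row_zero, Fin.sum_univ_succ]
    have : C.submatrix Fin.succ Fin.succ = 1 := by ext i j; simp [C]
    rw [Fin.succAbove_zero, this]
    simp [C]
  have hE : E.det = A.det := by
    rw [Matrix.det_succ_row_zero, Fin.sum_univ_succ]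
    have : E.submatrix Fin.succ Fin.succ = A := by ext i j; simp [E]
    rw [Fin.succAbove_zero, this]
    simp [E]
  rw [h, Matrix.det_mul, Matrix.det_mul, Matrix.det_transpose, hC, hE]
  ring

lemma measurable_blk {n : ℕ} : Measurable fun z : ℝ × (Fin n → ℝ) × Matrix (Fin n) (Fin n) ℝ =>
    blk z.1 z.2.1 z.2.2 := by
  refine measurable_toMatrix fun i j => ?_
  have := fun i j => (measurable_entry (n := n) (m := n) i j)
  refine Fin.cases ?_ (fun i => ?_) i <;> refine Fin.cases ?_ (fun j => ?_) j <;>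
    simp only [blk, Fin.cases_zero, Fin.cases_succ]
  · fun_prop
  · fun_prop
  · fun_prop
  · have h := (this i j).comp (measurable_snd.comp measurable_snd :
      Measurable fun z : ℝ × (Fin n → ℝ) × Matrix (Fin n) (Fin n) ℝ => z.2.2)
    simp only [Function.comp_def] at h
    fun_prop

lemma gram_cons {n p : ℕ} (r : ℝ) (x : Fin n → ℝ) (G : Fin n → Fin p → ℝ) :
    gramM (Fin.cons (Fin.cons r 0 : Fin (p+1) → ℝ) (fun i => (Fin.cons (x i) (G i) : Fin (p+1) → ℝ))
      : Fin (n+1) → Fin (p+1) → ℝ) = blk r x (gramM G) := by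
  ext i j
  rw [gram_apply, Fin.sum_univ_succ]
  refine Fin.cases ?_ (fun i => ?_) i <;> refine Fin.cases ?_ (fun j => ?_) j <;>
    simp [blk, gram_apply]

/-- Action of an isometry on plain vectors. -/
noncomputable def rot {p : ℕ} (U : EuclideanSpace ℝ (Fin p) ≃ₗᵢ[ℝ] EuclideanSpace ℝ (Fin p))
    (v : Fin p → ℝ) : Fin p → ℝ := WithLp.ofLp (U (WithLp.toLp 2 v))

lemma rot_preserving {p : ℕ} (U : EuclideanSpace ℝ (Fin p) ≃ₗᵢ[ℝ] EuclideanSpace ℝ (Fin p)) :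
    MeasurePreserving (rot U) (gau p) (gau p) := by
  have hm : Measurable (rot U) := by unfold rot; fun_prop
  refine ⟨hm, ?_⟩
  have h1 := stdGaussian_map U
  rw [← map_pi_eq_stdGaussian, Measure.map_map (by fun_prop) (by fun_prop)] at h1
  have h2 := congrArg (Measure.map (WithLp.ofLp : EuclideanSpace ℝ (Fin p) → _)) h1
  rw [Measure.map_map (by fun_prop) (by fun_prop), Measure.map_map (by fun_prop) (by fun_prop)] at h2
  have e : (WithLp.ofLp : EuclideanSpace ℝ (Fin p) → (Fin p → ℝ)) ∘ WithLp.toLp 2 = id := rfl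
  rw [e, Measure.map_id] at h2
  exact h2

lemma gram_rot {n p : ℕ} (U : EuclideanSpace ℝ (Fin p) ≃ₗᵢ[ℝ] EuclideanSpace ℝ (Fin p))
    (G : Fin n → Fin p → ℝ) : gramM (fun i => rot U (G i)) = gramM G := by
  ext i j
  have h := U.inner_map_map (WithLp.toLp 2 (G i)) (WithLp.toLp 2 (G j))
  rw [PiLp.inner_apply, PiLp.inner_apply] at h
  simp only [gram_apply, rot]
  simpa [mul_comm] using h

lemma exists_rot {p : ℕ} (v : Fin (p + 1) → ℝ) :
    ∃ U : EuclideanSpace ℝ (Fin (p+1)) ≃ₗᵢ[ℝ] EuclideanSpace ℝ (Fin (p+1)),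
      rot U v = Fin.cons (enrm v) 0 := by
  let w : EuclideanSpace ℝ (Fin (p+1)) := WithLp.toLp 2 (Fin.cons (enrm v) 0)
  have hw : ‖(WithLp.toLp 2 v : EuclideanSpace ℝ (Fin (p+1)))‖ = ‖w‖ := by
    change enrm v = enrm (Fin.cons (enrm v) 0 : Fin (p+1) → ℝ)
    rw [← sq_eq_sq₀ (enrm_nonneg _) (enrm_nonneg _), enrm_sq (Fin.cons (enrm v) 0 : Fin (p+1) → ℝ)]
    simp [Fin.sum_univ_succ]
  refine ⟨Submodule.reflection (ℝ ∙ (WithLp.toLp 2 v - w))ᗮ, ?_⟩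
  unfold rot
  rw [Submodule.reflection_sub hw]

lemma split_preserving (n p : ℕ) : MeasurePreserving
    (fun z : (Fin n → ℝ) × (Fin n → Fin p → ℝ) =>
      fun i => (Fin.cons (z.1 i) (z.2 i) : Fin (p+1) → ℝ))
    ((gau n).prod (gauM n p)) (gauM n (p + 1)) := by
  have h1 := (measurePreserving_arrowProdEquivProdArrow ℝ (Fin p → ℝ) (Fin n)
    (fun _ => gaussianReal 0 1) (fun _ => gau p)).symm
  have h2 := (measurePreserving_piFinSuccAbove (fun _ : Fin (p+1) => gaussianReal 0 1) 0).symm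
  have h3 := measurePreserving_pi (fun _ : Fin n => (gaussianReal 0 1).prod (gau p))
    (fun _ : Fin n => gau (p+1)) (fun _ => h2)
  have h4 := h3.comp h1
  convert h4 using 1
  funext z i
  simp [MeasurableEquiv.piFinSuccAbove, MeasurableEquiv.arrowProdEquivProdArrow]
  rfl

lemma cons_preserving (n p : ℕ) : MeasurePreserving
    (fun z : (Fin p → ℝ) × (Fin n → Fin p → ℝ) =>
      (Fin.cons z.1 z.2 : Fin (n+1) → Fin p → ℝ))
    ((gau p).prod (gauM n p)) (gauM (n + 1) p) := by
  have h2 := (measurePreserving_piFinSuccAbove (fun _ : Fin (n+1) => gau p) 0).symm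
  convert h2 using 1
  funext z
  simp [MeasurableEquiv.piFinSuccAbove]
  rfl

lemma gram_rec (n p : ℕ) (f : Matrix (Fin (n+1)) (Fin (n+1)) ℝ → ENNReal) (hf : Measurable f) :
    ∫⁻ A, f A ∂(wishart (n+1) (p+1)) =
      ∫⁻ g, (∫⁻ x, (∫⁻ A, f (blk (enrm g) x A) ∂(wishart n p)) ∂(gau n)) ∂(gau (p+1)) := by
  have hg := measurable_gram (n := n) (p := p)
  have hg' := measurable_gram (n := n + 1) (p := p + 1)
  rw [lintegral_wishart _ _ _ hf, ← (cons_preserving n (p+1)).lintegral_comp (by fun_prop)]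
  have hc := (cons_preserving n (p+1)).measurable
  rw [lintegral_prod _ (by fun_prop)]
  refine lintegral_congr fun g => ?_
  obtain ⟨U, hU⟩ := exists_rot g
  have hfc : Measurable fun G : Fin n → Fin (p+1) → ℝ =>
      f (gramM (Fin.cons (Fin.cons (enrm g) 0 : Fin (p+1) → ℝ) G : Fin (n+1) → Fin (p+1) → ℝ)) :=
    hf.comp (hg'.comp (hc.comp measurable_prodMk_left))
  have hrot := measurePreserving_pi (fun _ : Fin n => gau (p+1)) (fun _ : Fin n => gau (p+1))
    (fun _ => rot_preserving U)
  calc _ = ∫⁻ G : Fin n → Fin (p+1) → ℝ, f (gramM (Fin.cons (Fin.cons (enrm g) 0 : Fin (p+1) → ℝ)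
          (fun i => rot U (G i)) : Fin (n+1) → Fin (p+1) → ℝ)) ∂(gauM n (p+1)) := by
        refine lintegral_congr fun G => ?_
        rw [← gram_rot U]
        congr 2
        funext i
        refine Fin.cases ?_ (fun i => ?_) i <;> simp [hU]
    _ = ∫⁻ G : Fin n → Fin (p+1) → ℝ, f (gramM (Fin.cons (Fin.cons (enrm g) 0 : Fin (p+1) → ℝ)
          G : Fin (n+1) → Fin (p+1) → ℝ)) ∂(gauM n (p+1)) := hrot.lintegral_comp hfc
    _ = _ := by
        rw [← (split_preserving n p).lintegral_comp hfc]
        have hs := (split_preserving n p).measurable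
        have hfs := hfc.comp hs
        simp only [Function.comp_def] at hfs
        rw [lintegral_prod _ hfs.aemeasurable]
        refine lintegral_congr fun x => ?_
        rw [lintegral_wishart _ _ (fun A => f (blk (enrm g) x A))
          (hf.comp (measurable_blk.comp (by fun_prop :
            Measurable fun A : Matrix (Fin n) (Fin n) ℝ => (enrm g, x, A))))]
        refine lintegral_congr fun G => ?_
        rw [gram_cons]

lemma measurable_inner {n p : ℕ} (f : Matrix (Fin (n+1)) (Fin (n+1)) ℝ → ENNReal)
    (hf : Measurable f) :
    Measurable fun r : ℝ => ∫⁻ x, (∫⁻ A, f (blk r x A) ∂(wishart n p)) ∂(gau n) := by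
  have h : Measurable fun z : (ℝ × (Fin n → ℝ)) × Matrix (Fin n) (Fin n) ℝ =>
      f (blk z.1.1 z.1.2 z.2) := hf.comp (measurable_blk.comp (by fun_prop :
        Measurable fun z : (ℝ × (Fin n → ℝ)) × Matrix (Fin n) (Fin n) ℝ => (z.1.1, z.1.2, z.2)))
  exact (h.lintegral_prod_right' (ν := wishart n p)).lintegral_prod_right' (ν := gau n)

lemma det_nonneg_wishart (n p : ℕ) : ∀ᵐ A ∂(wishart n p), 0 ≤ A.det := by
  rw [wishart_eq, ae_map_iff measurable_gram.aemeasurable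
    (measurableSet_le measurable_const measurable_det')]
  refine Filter.Eventually.of_forall fun G => ?_
  have := Matrix.posSemidef_self_mul_conjTranspose (Matrix.of G)
  exact this.det_nonneg

lemma ofReal_sqrt_blk {n : ℕ} {r : ℝ} (hr : 0 ≤ r) (x : Fin n → ℝ) (A : Matrix (Fin n) (Fin n) ℝ) :
    ENNReal.ofReal √(blk r x A).det = ENNReal.ofReal r * ENNReal.ofReal √A.det := by
  rw [det_blk, Real.sqrt_mul (sq_nonneg r), Real.sqrt_sq hr, ENNReal.ofReal_mul hr]

lemma wishart_shift (n p : ℕ) (hnp : n ≤ p) : ∃ c : ENNReal,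
    ∀ f : Matrix (Fin n) (Fin n) ℝ → ENNReal, Measurable f →
      ∫⁻ A, f A ∂(wishart n (p+1)) = c * ∫⁻ A, ENNReal.ofReal √A.det * f A ∂(wishart n p) := by
  induction n generalizing p with
  | zero =>
    refine ⟨1, fun f hf => ?_⟩
    have : ∀ A, f A = f 0 := fun A => by rw [Subsingleton.elim A 0]
    simp [this]
  | succ n ih =>
    obtain ⟨q, rfl⟩ : ∃ q, p = q + 1 := ⟨p - 1, by omega⟩
    obtain ⟨c, hc⟩ := ih q (by omega)
    obtain ⟨k, hk⟩ := chi_shift q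
    have hdet := measurable_det' (n := n)
    have hdet' := measurable_det' (n := n + 1)
    refine ⟨k * c, fun f hf => ?_⟩
    have hb : ∀ (r : ℝ) (x : Fin n → ℝ), Measurable fun A => f (blk r x A) := fun r x =>
      hf.comp (measurable_blk.comp (by fun_prop :
            Measurable fun A : Matrix (Fin n) (Fin n) ℝ => (r, x, A)))
    have hb2 : ∀ (r : ℝ), Measurable fun x => ∫⁻ A, ENNReal.ofReal √A.det * f (blk r x A)
        ∂(wishart n q) := by
      intro r
      have h : Measurable fun z : (Fin n → ℝ) × Matrix (Fin n) (Fin n) ℝ =>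
        f (blk r z.1 z.2) := hf.comp (measurable_blk.comp (by fun_prop :
          Measurable fun z : (Fin n → ℝ) × Matrix (Fin n) (Fin n) ℝ => (r, z.1, z.2)))
      exact Measurable.lintegral_prod_right' (ν := wishart n q)
        (f := fun z : (Fin n → ℝ) × Matrix (Fin n) (Fin n) ℝ =>
          ENNReal.ofReal √z.2.det * f (blk r z.1 z.2))
        (Measurable.mul (by fun_prop) h)
    have hm := measurable_inner (p := q + 1) f hf
    have hm2 := measurable_inner (p := q) (fun A => ENNReal.ofReal √A.det * f A) (by fun_prop)
    rw [gram_rec _ _ _ hf, gram_rec _ _ _ (by fun_prop), hk _ hm, mul_assoc,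
      ← lintegral_const_mul c (by simpa only [Function.comp_def] using hm2.comp measurable_enrm)]
    congr 1
    refine lintegral_congr fun g => ?_
    simp_rw [ofReal_sqrt_blk (enrm_nonneg g)]
    simp only [mul_assoc]
    rw [lintegral_congr fun x => hc _ (hb (enrm g) x), lintegral_const_mul _ (hb2 _)]
    rw [lintegral_congr fun x => lintegral_const_mul (ENNReal.ofReal (enrm g))
      (f := fun A => ENNReal.ofReal √A.det * f (blk (enrm g) x A))
      (Measurable.mul (by fun_prop) (hb (enrm g) x)), lintegral_const_mul _ (hb2 _)]
    ring

/-- first moment of the determinant -/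
lemma moment_rec (n p k : ℕ) :
    ∫⁻ A, ENNReal.ofReal (A.det ^ k) ∂(wishart (n+1) (p+1)) =
      (∫⁻ g, ENNReal.ofReal (enrm g ^ (2 * k)) ∂(gau (p+1))) *
        ∫⁻ A, ENNReal.ofReal (A.det ^ k) ∂(wishart n p) := by
  have hdet := measurable_det' (n := n)
  have hdet' := measurable_det' (n := n + 1)
  have hm := measurable_enrm (m := p + 1)
  rw [gram_rec _ _ _ (by fun_prop), ← lintegral_mul_const _ (by fun_prop)]
  refine lintegral_congr fun g => ?_
  simp_rw [det_blk, mul_pow, ← pow_mul, ENNReal.ofReal_mul (pow_nonneg (enrm_nonneg g) _)]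
  simp_rw [lintegral_const_mul (ENNReal.ofReal (enrm g ^ (2 * k)))
    (f := fun A : Matrix (Fin n) (Fin n) ℝ => ENNReal.ofReal (A.det ^ k)) (by fun_prop)]
  simp

lemma moments (n p : ℕ) (hnp : n ≤ p) : ∃ a b : ℝ, 0 < a ∧ 0 < b ∧
    ∫⁻ A, ENNReal.ofReal (A.det ^ 1) ∂(wishart n p) = ENNReal.ofReal a ∧
    ∫⁻ A, ENNReal.ofReal (A.det ^ 2) ∂(wishart n p) = ENNReal.ofReal b ∧
    b / a ^ 2 = ((p : ℝ) + 1) * (p + 2) / ((p - n + 1) * (p - n + 2)) := by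
  induction n generalizing p with
  | zero =>
    refine ⟨1, 1, one_pos, one_pos, by simp, by simp, ?_⟩
    have : (0 : ℝ) ≤ p := by positivity
    simp
    rw [div_self (by positivity)]
  | succ n ih =>
    obtain ⟨q, rfl⟩ : ∃ q, p = q + 1 := ⟨p - 1, by omega⟩
    obtain ⟨a, b, ha, hb, h1, h2, h3⟩ := ih q (by omega)
    refine ⟨(q + 1) * a, (q + 1) * (q + 3) * b, by positivity, by positivity, ?_, ?_, ?_⟩
    · rw [moment_rec, h1, lintegral_enrm_sq, ENNReal.ofReal_mul (by positivity)]
      congr 1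
      rw [← ENNReal.ofReal_natCast]; push_cast; rfl
    · rw [moment_rec, h2, chi_moments, ENNReal.ofReal_mul (by positivity),
        ENNReal.ofReal_mul (by positivity)]
      congr 2
      · rw [← ENNReal.ofReal_natCast, ENNReal.ofReal_add (by positivity) (by positivity)]; simp
      · rw [ENNReal.ofReal_add (by positivity) (by positivity)]; simp
    · have hq : (n : ℝ) ≤ q := by exact_mod_cast (by omega : n ≤ q)
      have e : (q + 1) * (q + 3) * b / ((q + 1) * a) ^ 2 =
        ((q : ℝ) + 3) / (q + 1) * (b / a ^ 2) := by field_simp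
      rw [e, h3]
      have p1 : (0 : ℝ) < q - n + 1 := by linarith
      have p2 : (0 : ℝ) < q - n + 2 := by linarith
      push_cast
      have e1 : (q : ℝ) + 1 - (n + 1) + 1 = q - n + 1 := by ring
      have e2 : (q : ℝ) + 1 - (n + 1) + 2 = q - n + 2 := by ring
      rw [e1, e2]
      field_simp
      ring

/-- abstract total variation bound -/
lemma tv_abstract {Ω : Type*} [MeasurableSpace Ω] (μ ν : Measure Ω) [IsProbabilityMeasure μ]
    [IsProbabilityMeasure ν] (D : Ω → ℝ) (hD : Measurable D) (hD0 : ∀ᵐ w ∂μ, 0 ≤ D w)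
    (c : ENNReal) (hc : ∀ f : Ω → ENNReal, Measurable f →
      ∫⁻ w, f w ∂ν = c * ∫⁻ w, ENNReal.ofReal √(D w) * f w ∂μ)
    (a b : ℝ) (ha : 0 < a)
    (h1 : ∫⁻ w, ENNReal.ofReal (D w ^ 1) ∂μ = ENNReal.ofReal a)
    (h2 : ∫⁻ w, ENNReal.ofReal (D w ^ 2) ∂μ = ENNReal.ofReal b) (hb : 0 < b) :
    (∫ w, D w ∂μ = a) ∧ variance D μ = b - a ^ 2 ∧
    tvDist μ ν ≤ 1 / 2 * √(b / a ^ 2 - 1) := by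
  have hDi : Integrable D μ := by
    refine ⟨hD.aestronglyMeasurable, ?_⟩
    rw [hasFiniteIntegral_iff_ofReal hD0]
    simp only [pow_one] at h1
    rw [h1]; exact ENNReal.ofReal_lt_top
  have hD2i : Integrable (fun w => D w ^ 2) μ := by
    refine ⟨(hD.pow_const 2).aestronglyMeasurable, ?_⟩
    rw [hasFiniteIntegral_iff_ofReal (Filter.Eventually.of_forall fun w => sq_nonneg _), h2]
    exact ENNReal.ofReal_lt_top
  have hL : MemLp D 2 μ := (memLp_two_iff_integrable_sq hD.aestronglyMeasurable).2 hD2i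
  have E1 : ∫ w, D w ∂μ = a := by
    rw [integral_eq_lintegral_of_nonneg_ae hD0 hD.aestronglyMeasurable]
    simp only [pow_one] at h1
    rw [h1, ENNReal.toReal_ofReal ha.le]
  have E2 : ∫ w, D w ^ 2 ∂μ = b := by
    rw [integral_eq_lintegral_of_nonneg_ae (Filter.Eventually.of_forall fun w => sq_nonneg _)
      (hD.pow_const 2).aestronglyMeasurable, h2, ENNReal.toReal_ofReal hb.le]
  refine ⟨E1, ?_, ?_⟩
  · rw [variance_eq_sub hL]
    simp [E1, E2]
  -- the square root
  set X : Ω → ℝ := fun w => √(D w) with hX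
  have hXm : Measurable X := by fun_prop
  have hX0 : ∀ w, 0 ≤ X w := fun w => Real.sqrt_nonneg _
  have hX2 : ∀ᵐ w ∂μ, X w ^ 2 = D w := by
    filter_upwards [hD0] with w hw using Real.sq_sqrt hw
  have hX2i : Integrable (fun w => X w ^ 2) μ := hDi.congr (by filter_upwards [hX2] with w hw using hw.symm)
  have hXL : MemLp X 2 μ := (memLp_two_iff_integrable_sq hXm.aestronglyMeasurable).2 hX2i
  have hXi : Integrable X μ := hXL.integrable (by norm_num)
  have EX2 : ∫ w, X w ^ 2 ∂μ = a := by rw [integral_congr_ae hX2, E1]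
  set m := ∫ w, X w ∂μ with hm
  have hlX : ∫⁻ w, ENNReal.ofReal (X w) ∂μ = ENNReal.ofReal m := by
    rw [hm, ofReal_integral_eq_lintegral_ofReal hXi (Filter.Eventually.of_forall hX0)]
  have hn := hc (fun _ => 1) measurable_const
  simp only [mul_one, lintegral_one, measure_univ] at hn
  rw [hlX] at hn
  have hm0 : 0 < m := by
    by_contra h
    rw [ENNReal.ofReal_of_nonpos (not_lt.1 h)] at hn
    simp at hn
  have hc' : c = ENNReal.ofReal m⁻¹ := by
    rw [ENNReal.ofReal_inv_of_pos hm0]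
    exact ENNReal.eq_inv_of_mul_eq_one_left hn.symm
  -- Lyapunov
  have hLy : a ^ 3 ≤ b * m ^ 2 := by
    have hpt : ∀ᵐ w ∂μ, 3 * (a / m) ^ 2 * D w ≤ D w ^ 2 + 2 * (a / m) ^ 3 * X w := by
      filter_upwards [hX2] with w hw
      rw [← hw]
      have hs : 0 < a / m := by positivity
      have := mul_nonneg (mul_nonneg (hX0 w) (sq_nonneg (X w - a / m)))
        (by have := hX0 w; positivity : 0 ≤ X w + 2 * (a / m))
      nlinarith [this]
    have := integral_mono_ae (hDi.const_mul (3 * (a / m) ^ 2))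
      (hD2i.add (hXi.const_mul (2 * (a / m) ^ 3))) hpt
    simp only [Pi.add_apply] at this
    rw [integral_const_mul, integral_add hD2i (hXi.const_mul _), integral_const_mul, E1, E2,
      ← hm] at this
    field_simp at this
    nlinarith [this]
  -- pointwise difference of the measures
  let Y : Ω → ℝ := fun w => 1 - m⁻¹ * X w
  have hYi : Integrable Y μ := (integrable_const _).sub (hXi.const_mul _)
  have hY2 : ∫ w, Y w ^ 2 ∂μ = a / m ^ 2 - 1 := by
    have : ∀ w, Y w ^ 2 = 1 - 2 * m⁻¹ * X w + m⁻¹ ^ 2 * X w ^ 2 := fun w => by simp only [Y]; ring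
    simp_rw [this]
    have hi : Integrable (fun w => 1 - 2 * m⁻¹ * X w) μ :=
      (integrable_const _).sub (hXi.const_mul _)
    rw [integral_add hi (hX2i.const_mul _),
      integral_sub (integrable_const _) (hXi.const_mul _), integral_const_mul, integral_const_mul,
      EX2, ← hm]
    simp
    field_simp
    ring
  have hYL : MemLp Y 2 μ := (memLp_const _).sub (hXL.const_mul _)
  have hY0 : ∫ w, Y w ∂μ = 0 := by
    simp only [Y]
    rw [integral_sub (integrable_const _) (hXi.const_mul _), integral_const_mul, ← hm]
    simp [hm0.ne']
  have hCS : (∫ w, |Y w| ∂μ) ^ 2 ≤ a / m ^ 2 - 1 := by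
    have h := variance_nonneg (fun w => |Y w|) μ
    have hYa : MemLp (fun w => |Y w|) 2 μ := hYL.abs
    rw [variance_eq_sub hYa] at h
    simp only [Pi.pow_apply, sq_abs, hY2] at h
    linarith
  have hνA : ∀ A, MeasurableSet A → (ν A).toReal = ∫ w in A, m⁻¹ * X w ∂μ := by
    intro A hA
    have := hc (A.indicator 1) (measurable_one.indicator hA)
    rw [lintegral_indicator_one hA] at this
    have e : ∀ w, ENNReal.ofReal (X w) * A.indicator 1 w =
      A.indicator (fun w => ENNReal.ofReal (X w)) w := by
      intro w; by_cases h : w ∈ A <;> simp [h]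
    rw [lintegral_congr e, lintegral_indicator hA,
      ← ofReal_integral_eq_lintegral_ofReal hXi.integrableOn
        (Filter.Eventually.of_forall hX0), hc', ← ENNReal.ofReal_mul (by positivity)] at this
    rw [this, ENNReal.toReal_ofReal, integral_const_mul]
    exact mul_nonneg (by positivity) (integral_nonneg hX0)
  have hdiff : ∀ A, MeasurableSet A → (μ A).toReal - (ν A).toReal = ∫ w in A, Y w ∂μ := by
    intro A hA
    simp only [Y]
    rw [hνA A hA, integral_sub (integrable_const _) (hXi.const_mul _).integrableOn]
    simp [Measure.real]
  have hbound : ∀ A, MeasurableSet A →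
      |(μ A).toReal - (ν A).toReal| ≤ 1 / 2 * ∫ w, |Y w| ∂μ := by
    intro A hA
    rw [hdiff A hA]
    have s0 := integral_add_compl hA hYi
    have s1 := integral_add_compl hA hYi.abs
    rw [hY0] at s0
    have t1 := abs_integral_le_integral_abs (μ := μ.restrict A) (f := Y)
    have t2 := abs_integral_le_integral_abs (μ := μ.restrict Aᶜ) (f := Y)
    have e : ∫ w in Aᶜ, Y w ∂μ = - ∫ w in A, Y w ∂μ := by linarith
    rw [e, abs_neg] at t2
    linarith
  have hfin : ∫ w, |Y w| ∂μ ≤ √(b / a ^ 2 - 1) := by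
    refine Real.le_sqrt_of_sq_le (hCS.trans ?_)
    gcongr ?_ - 1
    rw [div_le_div_iff₀ (by positivity) (by positivity)]
    linarith [hLy, pow_succ a 2]
  unfold tvDist
  have : Nonempty {s : Set Ω // MeasurableSet s} := ⟨⟨∅, MeasurableSet.empty⟩⟩
  refine ciSup_le fun A => (hbound A A.2).trans ?_
  gcongr

/-- `d_TV(W_n(Id,d-1), W_n(Id,d)) ≤ (1/2)·√(Var[det W]/E[det W]²)` for
`W ∼ W_n(Id, d-1)`, and in particular it is at most
`(1/2)·√(d(d+1)/((d-n)(d-n+1)) - 1)`. -/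
theorem tv_wishart_bound (n d : ℕ) (hn : 0 < n) (hnd : n ≤ d - 1) (hd : 1 ≤ d) :
    tvDist (wishart n (d - 1)) (wishart n d) ≤
      (1 / 2) * Real.sqrt (variance (fun A => A.det) (wishart n (d - 1)) /
        (∫ A, A.det ∂(wishart n (d - 1))) ^ 2) ∧
    tvDist (wishart n (d - 1)) (wishart n d) ≤
      (1 / 2) * Real.sqrt (((d : ℝ) * (d + 1)) / (((d : ℝ) - n) * ((d : ℝ) - n + 1)) - 1) := by
  obtain ⟨p, rfl⟩ : ∃ p, d = p + 1 := ⟨d - 1, by omega⟩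
  simp only [Nat.add_sub_cancel] at hnd ⊢
  obtain ⟨c, hc⟩ := wishart_shift n p hnd
  obtain ⟨a, b, ha, hb, h1, h2, h3⟩ := moments n p hnd
  obtain ⟨E1, V, T⟩ := tv_abstract (wishart n p) (wishart n (p + 1)) (fun A => A.det)
    measurable_det' (det_nonneg_wishart n p) c hc a b ha h1 h2 hb
  constructor
  · rw [E1, V, sub_div, div_self (by positivity)]
    exact T
  · rw [h3] at T
    convert T using 6 <;> push_cast <;> ring
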